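/- arXiv:1407.4288 — 8 statements merged into one kernel-verified Lean document; each statement's English description precedes it below -/
import Mathlib

section
/- For a finite set N and a family S of subsets of N, the poset (S, ⊆) is the underlying interval poset of some interval in the lattice of antichains A_N (i.e. S = P_{[α,β]} for some antichains α ≤ β) if and only if S is convex: for all A₁, A₂ ∈ S and all X ⊆ N with A₁ ⊆ X ⊆ A₂ one has X ∈ S. Moreover, in that case S = P_{[γ,δ]} where γ = ⋁_{X ∈ S} (X⁻ \ S) and δ = ⋁_{X ∈ S} {X}. -/
/-!
Antichains of subsets of a finite universe
(following De Causmaecker & De Wannemacker,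
"On the number of antichains of sets in a finite universe").
-/

open scoped Classical

namespace Antichains

variable {V : Type*} [DecidableEq V]

/-- The `max` operator: keep only the non-dominated members of a family of sets. -/
def maxl (S : Finset (Finset V)) : Finset (Finset V) :=
  S.filter fun X => ∀ Y ∈ S, ¬X ⊂ Y

/-- `A` is an antichain of subsets: no two members are in a subset-superset relation. -/
def IsAC (A : Finset (Finset V)) : Prop :=
  ∀ X ∈ A, ∀ Y ∈ A, X ⊆ Y → X = Y

/-- The domination (partial) order on antichains: `acle A B` iff every member of `A`
is contained in some member of `B`. -/
def acle (A B : Finset (Finset V)) : Prop :=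
  ∀ X ∈ A, ∃ Y ∈ B, X ⊆ Y

/-- Strict domination. -/
def aclt (A B : Finset (Finset V)) : Prop :=
  acle A B ∧ ¬acle B A

/-- Join of antichains: `A ∨ B = max (A ∪ B)`. -/
def acjoin (A B : Finset (Finset V)) : Finset (Finset V) :=
  maxl (A ∪ B)

/-- Meet of antichains: `A ∧ B = max {X ∩ Y | X ∈ A, Y ∈ B}`. -/
def acmeet (A B : Finset (Finset V)) : Finset (Finset V) :=
  maxl ((A ×ˢ B).image fun p => p.1 ∩ p.2)

/-- `X⁻`: the antichain of immediate subsets of `X`. -/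
def im (X : Finset V) : Finset (Finset V) :=
  X.image fun x => X.erase x

/-- The interval poset `P_[a,b] = {X | a ∨ {X} ∈ (a,b]}`. -/
noncomputable def iposet [Fintype V] (a b : Finset (Finset V)) : Finset (Finset V) :=
  Finset.univ.filter fun X : Finset V => aclt a (acjoin a {X}) ∧ acle (acjoin a {X}) b

/-- `χ` belongs, as an antichain, to the interval `[a,b]`. -/
def memI (a b χ : Finset (Finset V)) : Prop :=
  IsAC χ ∧ acle a χ ∧ acle χ b

/-- The bottom of the interval canonically spanned by an interval poset `S`:
`⋁_{X ∈ S} (X⁻ \ S)`. -/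
def ibot (S : Finset (Finset V)) : Finset (Finset V) :=
  maxl (S.biUnion fun X => im X \ S)

/-- The top of the interval canonically spanned by an interval poset `S`:
`⋁_{X ∈ S} {X}`. -/
def itop (S : Finset (Finset V)) : Finset (Finset V) :=
  maxl S

theorem mem_of_mem_maxl {S : Finset (Finset V)} {X : Finset V} (h : X ∈ maxl S) : X ∈ S :=
  (Finset.mem_filter.1 h).1

theorem isAC_maxl (S : Finset (Finset V)) : IsAC (maxl S) := fun X hX Y hY hXY => by
  by_contra hne
  exact (Finset.mem_filter.1 hX).2 Y (mem_of_mem_maxl hY)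
    (Finset.ssubset_iff_subset_ne.2 ⟨hXY, hne⟩)

theorem exists_mem_maxl_superset {S : Finset (Finset V)} {X : Finset V} (h : X ∈ S) :
    ∃ Y ∈ maxl S, X ⊆ Y := by
  obtain ⟨Y, hXY, hY⟩ := S.exists_le_maximal h
  exact ⟨Y, Finset.mem_filter.2 ⟨hY.prop, fun Z hZ hYZ => hY.not_gt hZ hYZ⟩, hXY⟩

/-- Passing to maximal members does not change what is dominated by a family. -/
theorem exists_mem_maxl_iff {S : Finset (Finset V)} {X : Finset V} :
    (∃ Y ∈ maxl S, X ⊆ Y) ↔ ∃ Y ∈ S, X ⊆ Y := by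
  constructor
  · rintro ⟨Y, hY, hXY⟩
    exact ⟨Y, mem_of_mem_maxl hY, hXY⟩
  · rintro ⟨Y, hY, hXY⟩
    obtain ⟨Z, hZ, hYZ⟩ := exists_mem_maxl_superset hY
    exact ⟨Z, hZ, hXY.trans hYZ⟩

theorem acle_maxl_left {A B : Finset (Finset V)} : acle (maxl A) B ↔ acle A B := by
  constructor
  · intro h X hX
    obtain ⟨Y, hY, hXY⟩ := exists_mem_maxl_superset hX
    obtain ⟨Z, hZ, hYZ⟩ := h Y hY
    exact ⟨Z, hZ, hXY.trans hYZ⟩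
  · exact fun h X hX => h X (mem_of_mem_maxl hX)

theorem acle_maxl_right {A B : Finset (Finset V)} : acle A (maxl B) ↔ acle A B :=
  forall₂_congr fun _ _ => exists_mem_maxl_iff

theorem acle_acjoin_left (A B : Finset (Finset V)) : acle A (acjoin A B) :=
  acle_maxl_right.2 fun X hX => ⟨X, Finset.mem_union_left _ hX, subset_rfl⟩

theorem acjoin_singleton_acle {A B : Finset (Finset V)} {X : Finset V} :
    acle (acjoin A {X}) B ↔ acle A B ∧ ∃ Y ∈ B, X ⊆ Y := by
  rw [acjoin, acle_maxl_left]
  constructor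
  · exact fun h => ⟨fun Y hY => h Y (Finset.mem_union_left _ hY),
      h X (Finset.mem_union_right _ (Finset.mem_singleton_self X))⟩
  · rintro ⟨h, hX⟩ Y hY
    rcases Finset.mem_union.1 hY with hY | hY
    · exact h Y hY
    · rwa [Finset.mem_singleton.1 hY]

theorem mem_iposet [Fintype V] {a b : Finset (Finset V)} {X : Finset V} :
    X ∈ iposet a b ↔ acle a b ∧ (∃ Y ∈ b, X ⊆ Y) ∧ ¬∃ Y ∈ a, X ⊆ Y := by
  have haa : acle a a := fun Y hY => ⟨Y, hY, subset_rfl⟩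
  simp only [iposet, Finset.mem_filter, Finset.mem_univ, true_and, aclt, acjoin_singleton_acle,
    haa, acle_acjoin_left]
  rw [and_comm, and_assoc]

theorem iposet_convex [Fintype V] {a b : Finset (Finset V)} {A₁ A₂ X : Finset V}
    (h₁ : A₁ ∈ iposet a b) (h₂ : A₂ ∈ iposet a b) (h₁X : A₁ ⊆ X) (hX₂ : X ⊆ A₂) :
    X ∈ iposet a b := by
  obtain ⟨hab, -, hA₁⟩ := mem_iposet.1 h₁
  obtain ⟨-, ⟨Y, hY, hA₂⟩, -⟩ := mem_iposet.1 h₂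
  exact mem_iposet.2 ⟨hab, ⟨Y, hY, hX₂.trans hA₂⟩,
    fun ⟨Z, hZ, hXZ⟩ => hA₁ ⟨Z, hZ, h₁X.trans hXZ⟩⟩

theorem mem_im {X Y : Finset V} : Y ∈ im X ↔ ∃ x ∈ X, X.erase x = Y := Finset.mem_image

theorem exists_mem_ibot_iff {S : Finset (Finset V)} {X : Finset V} :
    (∃ Y ∈ ibot S, X ⊆ Y) ↔ ∃ Z ∈ S, ∃ z ∈ Z, Z.erase z ∉ S ∧ X ⊆ Z.erase z := by
  rw [ibot, exists_mem_maxl_iff]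
  constructor
  · rintro ⟨Y, hY, hXY⟩
    obtain ⟨Z, hZ, hYZ⟩ := Finset.mem_biUnion.1 hY
    obtain ⟨hY, hYS⟩ := Finset.mem_sdiff.1 hYZ
    obtain ⟨z, hz, rfl⟩ := mem_im.1 hY
    exact ⟨Z, hZ, z, hz, hYS, hXY⟩
  · rintro ⟨Z, hZ, z, hz, hS, hX⟩
    exact ⟨_, Finset.mem_biUnion.2 ⟨Z, hZ, Finset.mem_sdiff.2 ⟨mem_im.2 ⟨z, hz, rfl⟩, hS⟩⟩, hX⟩

theorem ibot_acle_itop (S : Finset (Finset V)) : acle (ibot S) (itop S) := by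
  intro X hX
  obtain ⟨Z, hZ, z, -, -, h⟩ := exists_mem_ibot_iff.1 ⟨X, hX, subset_rfl⟩
  exact exists_mem_maxl_iff.2 ⟨Z, hZ, h.trans (Finset.erase_subset _ _)⟩

theorem eq_iposet_ibot_itop [Fintype V] {S : Finset (Finset V)}
    (hS : ∀ A₁ ∈ S, ∀ A₂ ∈ S, ∀ X : Finset V, A₁ ⊆ X → X ⊆ A₂ → X ∈ S) :
    S = iposet (ibot S) (itop S) := by
  ext X
  rw [mem_iposet, exists_mem_ibot_iff, itop, exists_mem_maxl_iff]
  constructor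
  · intro hX
    refine ⟨ibot_acle_itop S, ⟨X, hX, subset_rfl⟩, ?_⟩
    rintro ⟨Z, hZ, z, -, hzS, hXz⟩
    exact hzS (hS X hX Z hZ _ hXz (Finset.erase_subset _ _))
  · rintro ⟨-, ⟨Y, hY, hXY⟩, hbot⟩
    by_contra hX
    obtain ⟨Z, hZ⟩ := (S.filter (X ⊆ ·)).exists_minimal ⟨Y, Finset.mem_filter.2 ⟨hY, hXY⟩⟩
    obtain ⟨hZS, hXZ⟩ := Finset.mem_filter.1 hZ.prop
    have hne : X ≠ Z := fun h => hX (h ▸ hZS)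
    obtain ⟨z, hz, hzX⟩ := Finset.exists_of_ssubset (Finset.ssubset_iff_subset_ne.2 ⟨hXZ, hne⟩)
    have hXe : X ⊆ Z.erase z := Finset.subset_erase.2 ⟨hXZ, hzX⟩
    exact hbot ⟨Z, hZS, z, hz, fun h =>
      hZ.not_lt (Finset.mem_filter.2 ⟨h, hXe⟩) (Finset.erase_ssubset hz), hXe⟩

/-- Lemma 1 of the paper.  A family `S` of subsets of the (finite)
universe is the interval poset of some interval of antichains iff it is convex, and in
that case it spans `[⋁_{X ∈ S} (X⁻ \ S), ⋁_{X ∈ S} {X}]`. -/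
theorem statement0 {V : Type*} [DecidableEq V] [Fintype V] (S : Finset (Finset V)) :
    ((∃ a b : Finset (Finset V), IsAC a ∧ IsAC b ∧ acle a b ∧ S = iposet a b) ↔
      ∀ A₁ ∈ S, ∀ A₂ ∈ S, ∀ X : Finset V, A₁ ⊆ X → X ⊆ A₂ → X ∈ S) ∧
    ((∀ A₁ ∈ S, ∀ A₂ ∈ S, ∀ X : Finset V, A₁ ⊆ X → X ⊆ A₂ → X ∈ S) →
      S = iposet (ibot S) (itop S)) := by
  refine ⟨⟨?_, fun hS => ⟨ibot S, itop S, isAC_maxl _, isAC_maxl _, ibot_acle_itop S,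
    eq_iposet_ibot_itop hS⟩⟩, eq_iposet_ibot_itop⟩
  rintro ⟨a, b, -, -, -, rfl⟩ A₁ h₁ A₂ h₂ X h₁X hX₂
  exact iposet_convex h₁ h₂ h₁X hX₂

end Antichains
end

section
/- Let S be an interval poset of subsets of a finite set N and A ⊆ N a set such that every X ∈ S containing at least one element of A contains all of A. Fix a ∈ A. Then the poset S' = {(X \ A) ∪ {a} | X ∈ S, A ⊆ X} ∪ {X | X ∈ S, A ⊄ X}, ordered by inclusion, is order isomorphic to S. -/
/-!
Antichains of subsets of a finite universe
(following De Causmaecker & De Wannemacker,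
"On the number of antichains of sets in a finite universe").
-/

open scoped Classical

namespace Antichains

variable {V : Type*} [DecidableEq V]

/-- `S` is the interval poset of some interval of antichains. -/
def IsIntervalPoset [Fintype V] (S : Finset (Finset V)) : Prop :=
  ∃ a b : Finset (Finset V), IsAC a ∧ IsAC b ∧ acle a b ∧ S = iposet a b

/-- If every member of `S` meeting `A` contains `A`, then removing all elements of `A` but `a`
preserves and reflects inclusion between members of `S`. -/
theorem sdiff_erase_subset_sdiff_erase_iff {V : Type*} [DecidableEq V] {S : Finset (Finset V)}
    {A : Finset V} {a : V} (ha : a ∈ A) (hA : ∀ X ∈ S, (∃ x ∈ A, x ∈ X) → A ⊆ X)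
    {X Y : Finset V} (hX : X ∈ S) (hY : Y ∈ S) :
    X \ A.erase a ⊆ Y \ A.erase a ↔ X ⊆ Y := by
  refine ⟨fun h x hx => ?_, fun h => Finset.sdiff_subset_sdiff h subset_rfl⟩
  by_cases hxA : x ∈ A
  · have haX : a ∈ X := hA X hX ⟨x, hxA, hx⟩ ha
    have haY : a ∈ Y := (Finset.mem_sdiff.1 (h (by simp [haX]))).1
    exact hA Y hY ⟨a, ha, haY⟩ hxA
  · exact (Finset.mem_sdiff.1 (h (by simp [hx, hxA]))).1

theorem sdiff_erase_of_subset {V : Type*} [DecidableEq V] {A X : Finset V} {a : V}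
    (ha : a ∈ A) (h : A ⊆ X) : X \ A.erase a = (X \ A) ∪ {a} := by
  rw [Finset.sdiff_erase (h ha), Finset.insert_eq, Finset.union_comm]

/-- Lemma 4 of the paper.  Let `S` be an interval poset such that
every member of `S` meeting the set `A` contains all of `A`, and let `a ∈ A`.  Then the
poset `S' = {(X \ A) ∪ {a} | X ∈ S, A ⊆ X} ∪ {X | X ∈ S, ¬A ⊆ X}`, ordered by
inclusion, is order isomorphic to `S`. -/
theorem statement3 {V : Type*} [DecidableEq V] [Fintype V] (S : Finset (Finset V))
    (hS : IsIntervalPoset S) (A : Finset V) (a : V) (ha : a ∈ A)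
    (hA : ∀ X ∈ S, (∃ x ∈ A, x ∈ X) → A ⊆ X) :
    Nonempty
      ({Y // Y ∈ ((S.filter fun X => A ⊆ X).image fun X => (X \ A) ∪ {a}) ∪
          (S.filter fun X => ¬A ⊆ X)} ≃o {X // X ∈ S}) := by
  have sdiff_erase_of_not_subset : ∀ X ∈ S, ¬A ⊆ X → X \ A.erase a = X := fun X hX h =>
    Finset.sdiff_eq_self_of_disjoint <| Finset.disjoint_left.2 fun x hxX hxA =>
      h (hA X hX ⟨x, Finset.mem_of_mem_erase hxA, hxX⟩)
  have mem : ∀ X : {X // X ∈ S}, X.1 \ A.erase a ∈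
      ((S.filter fun X => A ⊆ X).image fun X => (X \ A) ∪ {a}) ∪
        (S.filter fun X => ¬A ⊆ X) := by
    rintro ⟨X, hX⟩
    by_cases h : A ⊆ X
    · exact Finset.mem_union_left _ <| Finset.mem_image.2
        ⟨X, Finset.mem_filter.2 ⟨hX, h⟩, (sdiff_erase_of_subset ha h).symm⟩
    · refine Finset.mem_union_right _ <| Finset.mem_filter.2 ?_
      rw [sdiff_erase_of_not_subset X hX h]
      exact ⟨hX, h⟩
  let f : {X // X ∈ S} ↪o {Y // Y ∈ ((S.filter fun X => A ⊆ X).image fun X => (X \ A) ∪ {a}) ∪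
      (S.filter fun X => ¬A ⊆ X)} :=
    OrderEmbedding.ofMapLEIff (fun X => ⟨X.1 \ A.erase a, mem X⟩)
      fun X Y => sdiff_erase_subset_sdiff_erase_iff ha hA X.2 Y.2
  refine ⟨(RelIso.ofSurjective f ?_).symm⟩
  rintro ⟨Y, hY⟩
  rcases Finset.mem_union.1 hY with h | h
  · obtain ⟨X, hX, rfl⟩ := Finset.mem_image.1 h
    obtain ⟨hXS, hAX⟩ := Finset.mem_filter.1 hX
    exact ⟨⟨X, hXS⟩, Subtype.ext (sdiff_erase_of_subset ha hAX)⟩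
  · obtain ⟨hYS, hAY⟩ := Finset.mem_filter.1 h
    exact ⟨⟨Y, hYS⟩, Subtype.ext (sdiff_erase_of_not_subset Y hYS hAY)⟩

end Antichains
end

section
/- Let N be a finite set, A ⊂ N, and let χ' ≤ χ be antichains of subsets of N \ A. Set β = {A} ⊗ χ and α = ({A} ⊗ χ') ∨ (A⁻ ⊗ χ). Then the interval [α, β] in A_N is lattice isomorphic to the interval [χ', χ] in A_{N \ A}. -/
/-!
Antichains of subsets of a finite universe
(following De Causmaecker & De Wannemacker,
"On the number of antichains of sets in a finite universe").
-/

open scoped Classical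

namespace Antichains

variable {V : Type*} [DecidableEq V]

/-- Direct product of two antichains (with disjoint spans):
`a ⊗ b = {X ∪ Y | X ∈ a, Y ∈ b}`. -/
def dprod (a b : Finset (Finset V)) : Finset (Finset V) :=
  (a ×ˢ b).image fun p => p.1 ∪ p.2

/-- `X` lies in the downset generated by the family `S`. -/
def Below (S : Finset (Finset V)) (X : Finset V) : Prop :=
  ∃ Y ∈ S, X ⊆ Y

omit [DecidableEq V] in
theorem acle_iff_below {S T : Finset (Finset V)} :
    acle S T ↔ ∀ X, Below S X → Below T X := by
  constructor
  · rintro h X ⟨Y, hY, hXY⟩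
    obtain ⟨Z, hZ, hYZ⟩ := h Y hY
    exact ⟨Z, hZ, hXY.trans hYZ⟩
  · exact fun h X hX => h X ⟨X, hX, Finset.Subset.refl X⟩

omit [DecidableEq V] in
theorem IsAC.eq_of_below_iff {S T : Finset (Finset V)} (hS : IsAC S) (hT : IsAC T)
    (h : ∀ X, Below S X ↔ Below T X) : S = T := by
  have key : ∀ {S T : Finset (Finset V)}, IsAC S → (∀ X, Below S X ↔ Below T X) → S ⊆ T := by
    intro S T hS h X hX
    obtain ⟨Y, hY, hXY⟩ := (h X).1 ⟨X, hX, Finset.Subset.refl X⟩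
    obtain ⟨Z, hZ, hYZ⟩ := (h Y).2 ⟨Y, hY, Finset.Subset.refl Y⟩
    obtain rfl := hS X hX Z hZ (hXY.trans hYZ)
    rwa [hXY.antisymm hYZ]
  exact (key hS h).antisymm (key hT fun X => (h X).symm)

theorem below_maxl {S : Finset (Finset V)} {X : Finset V} : Below (maxl S) X ↔ Below S X := by
  constructor
  · rintro ⟨Y, hY, hXY⟩
    exact ⟨Y, (Finset.mem_filter.1 hY).1, hXY⟩
  · rintro ⟨Y, hY, hXY⟩
    obtain ⟨Z, hYZ, hZ⟩ := S.exists_le_maximal hY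
    exact ⟨Z, Finset.mem_filter.2 ⟨hZ.prop, fun W hW => hZ.not_gt hW⟩, hXY.trans hYZ⟩

theorem below_acjoin {S T : Finset (Finset V)} {X : Finset V} :
    Below (acjoin S T) X ↔ Below S X ∨ Below T X := by
  rw [acjoin, below_maxl]
  simp only [Below, Finset.mem_union, or_and_right, exists_or]

theorem below_acmeet {S T : Finset (Finset V)} {X : Finset V} :
    Below (acmeet S T) X ↔ Below S X ∧ Below T X := by
  rw [acmeet, below_maxl]
  constructor
  · rintro ⟨_, hW, hX⟩
    obtain ⟨⟨Y, Z⟩, hp, rfl⟩ := Finset.mem_image.1 hW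
    obtain ⟨hY, hZ⟩ := Finset.mem_product.1 hp
    exact ⟨⟨Y, hY, hX.trans Finset.inter_subset_left⟩, Z, hZ, hX.trans Finset.inter_subset_right⟩
  · rintro ⟨⟨Y, hY, hXY⟩, Z, hZ, hXZ⟩
    exact ⟨Y ∩ Z, Finset.mem_image.2 ⟨(Y, Z), Finset.mem_product.2 ⟨hY, hZ⟩, rfl⟩,
      Finset.subset_inter hXY hXZ⟩

theorem below_dprod {S T : Finset (Finset V)} {X : Finset V} :
    Below (dprod S T) X ↔ ∃ Y ∈ S, ∃ Z ∈ T, X ⊆ Y ∪ Z := by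
  simp only [Below, dprod, Finset.mem_image, Finset.mem_product, Prod.exists]
  constructor
  · rintro ⟨_, ⟨Y, Z, ⟨hY, hZ⟩, rfl⟩, hX⟩
    exact ⟨Y, hY, Z, hZ, hX⟩
  · rintro ⟨Y, hY, Z, hZ, hX⟩
    exact ⟨_, ⟨Y, Z, ⟨hY, hZ⟩, rfl⟩, hX⟩

theorem below_singleton_dprod {A X : Finset V} {S : Finset (Finset V)} :
    Below (dprod {A} S) X ↔ Below S (X \ A) := by
  rw [below_dprod]
  simp only [Below, Finset.mem_singleton, exists_eq_left, sdiff_le_iff,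
    Finset.sup_eq_union]

theorem below_im_dprod {A X : Finset V} {S : Finset (Finset V)} (hS : ∀ Y ∈ S, Disjoint Y A) :
    Below (dprod (im A) S) X ↔ ¬A ⊆ X ∧ Below S (X \ A) := by
  rw [below_dprod]
  constructor
  · rintro ⟨_, hY, Z, hZ, hX⟩
    obtain ⟨a, ha, rfl⟩ := Finset.mem_image.1 hY
    refine ⟨fun hAX => ?_, Z, hZ, fun v hv => ?_⟩
    · have := Finset.disjoint_right.1 (hS Z hZ) ha
      simpa [this] using hX (hAX ha)
    · have := hX (Finset.mem_sdiff.1 hv).1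
      simpa [(Finset.mem_sdiff.1 hv).2] using this
  · rintro ⟨hAX, Z, hZ, hXZ⟩
    obtain ⟨a, ha, haX⟩ := Finset.not_subset.1 hAX
    refine ⟨A.erase a, Finset.mem_image_of_mem _ ha, Z, hZ, fun v hv => ?_⟩
    by_cases hvA : v ∈ A
    · exact Finset.mem_union_left _ (Finset.mem_erase.2 ⟨fun h => haX (h ▸ hv), hvA⟩)
    · exact Finset.mem_union_right _ (hXZ (Finset.mem_sdiff.2 ⟨hv, hvA⟩))

/-- The link of `A` in the family `S`: the members containing `A`, with `A` removed. -/
def link (A : Finset V) (S : Finset (Finset V)) : Finset (Finset V) :=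
  (S.filter fun X => A ⊆ X).image fun X => X \ A

theorem IsAC.link {S : Finset (Finset V)} (hS : IsAC S) (A : Finset V) : IsAC (link A S) := by
  intro X hX Y hY hXY
  obtain ⟨X, hX', rfl⟩ := Finset.mem_image.1 hX
  obtain ⟨Y, hY', rfl⟩ := Finset.mem_image.1 hY
  obtain ⟨hX, hAX⟩ := Finset.mem_filter.1 hX'
  obtain ⟨hY, hAY⟩ := Finset.mem_filter.1 hY'
  have h : X ⊆ Y := by
    rw [← Finset.sdiff_union_of_subset hAX, ← Finset.sdiff_union_of_subset hAY]
    exact Finset.union_subset_union_left hXY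
  rw [hS X hX Y hY h]

theorem below_link {A X : Finset V} {S : Finset (Finset V)} :
    Below (link A S) X ↔ Disjoint X A ∧ Below S (A ∪ X) := by
  constructor
  · rintro ⟨_, hY, hX⟩
    obtain ⟨Y, hY', rfl⟩ := Finset.mem_image.1 hY
    obtain ⟨hY, hAY⟩ := Finset.mem_filter.1 hY'
    obtain ⟨hXY, hXA⟩ := Finset.subset_sdiff.1 hX
    exact ⟨hXA, Y, hY, Finset.union_subset hAY hXY⟩
  · rintro ⟨hXA, Y, hY, hX⟩
    obtain ⟨hAY, hXY⟩ := Finset.union_subset_iff.1 hX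
    exact ⟨Y \ A, Finset.mem_image_of_mem _ (Finset.mem_filter.2 ⟨hY, hAY⟩),
      Finset.subset_sdiff.2 ⟨hXY, hXA⟩⟩

theorem link_acjoin (A : Finset V) {S T : Finset (Finset V)} :
    link A (acjoin S T) = acjoin (link A S) (link A T) := by
  refine ((isAC_maxl _).link A).eq_of_below_iff (isAC_maxl _) fun X => ?_
  change Below (link A (acjoin S T)) X ↔ Below (acjoin (link A S) (link A T)) X
  simp only [below_link, below_acjoin]
  tauto

theorem link_acmeet (A : Finset V) {S T : Finset (Finset V)} :
    link A (acmeet S T) = acmeet (link A S) (link A T) := by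
  refine ((isAC_maxl _).link A).eq_of_below_iff (isAC_maxl _) fun X => ?_
  change Below (link A (acmeet S T)) X ↔ Below (acmeet (link A S) (link A T)) X
  simp only [below_link, below_acmeet]
  tauto

/-- Lemma 6 of the paper.  Let `A ⊂ N` (the universe) and let
`χ' ≤ χ` be antichains of subsets of `N \ A`.  With `β = {A} ⊗ χ` and
`α = ({A} ⊗ χ') ∨ (A⁻ ⊗ χ)`, the interval `[α, β]` is lattice isomorphic to
`[χ', χ]` : there is a bijection between the two intervals preserving join and meet. -/
theorem statement5 {V : Type*} [DecidableEq V] [Fintype V] (A : Finset V)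
    (hA : A ⊂ Finset.univ) (χ' χ : Finset (Finset V))
    (hχ' : IsAC χ') (hχ : IsAC χ)
    (hs' : ∀ X ∈ χ', X ⊆ Aᶜ) (hs : ∀ X ∈ χ, X ⊆ Aᶜ)
    (hle : acle χ' χ) :
    ∃ f : Finset (Finset V) → Finset (Finset V),
      Set.BijOn f
        {σ | memI (acjoin (dprod {A} χ') (dprod (im A) χ)) (dprod {A} χ) σ}
        {σ | memI χ' χ σ} ∧
      ∀ x y : Finset (Finset V),
        memI (acjoin (dprod {A} χ') (dprod (im A) χ)) (dprod {A} χ) x →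
        memI (acjoin (dprod {A} χ') (dprod (im A) χ)) (dprod {A} χ) y →
          f (acjoin x y) = acjoin (f x) (f y) ∧ f (acmeet x y) = acmeet (f x) (f y) := by
  have disj : ∀ {S : Finset (Finset V)}, (∀ X ∈ S, X ⊆ Aᶜ) → ∀ X, Below S X → Disjoint X A := by
    rintro S hS X ⟨Y, hY, hXY⟩
    exact Finset.subset_compl_iff_disjoint_right.1 (hXY.trans (hS Y hY))
  have hχA := disj hs
  have hχA' : ∀ X ∈ χ, Disjoint X A := fun X hX => hχA X ⟨X, hX, Finset.Subset.refl X⟩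
  have union_sdiff : ∀ {X : Finset V}, Disjoint X A → (A ∪ X) \ A = X := fun h =>
    Finset.union_sdiff_cancel_left h.symm
  refine ⟨link A, ⟨?_, ?_, ?_⟩, fun x y _ _ => ⟨link_acjoin A, link_acmeet A⟩⟩
  · rintro σ ⟨hσ, hασ, hσβ⟩
    rw [acle_iff_below] at hασ hσβ
    refine ⟨hσ.link A, acle_iff_below.2 fun X hX => ?_, acle_iff_below.2 fun X hX => ?_⟩
    · have hXA := disj hs' X hX
      refine below_link.2 ⟨hXA, hασ _ (below_acjoin.2 (Or.inl (below_singleton_dprod.2 ?_)))⟩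
      rwa [union_sdiff hXA]
    · obtain ⟨hXA, hX⟩ := below_link.1 hX
      have := below_singleton_dprod.1 (hσβ _ hX)
      rwa [union_sdiff hXA] at this
  · have key : ∀ σ τ,
        memI (acjoin (dprod {A} χ') (dprod (im A) χ)) (dprod {A} χ) σ →
        memI (acjoin (dprod {A} χ') (dprod (im A) χ)) (dprod {A} χ) τ →
        link A σ = link A τ → ∀ X, Below σ X → Below τ X := by
      rintro σ τ ⟨-, -, hσβ⟩ ⟨-, hατ, -⟩ h X hX
      rw [acle_iff_below] at hσβ hατ
      by_cases hAX : A ⊆ X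
      · have hσX : Below (link A σ) (X \ A) :=
          below_link.2 ⟨Finset.sdiff_disjoint, by rwa [Finset.union_sdiff_of_subset hAX]⟩
        rw [h, below_link, Finset.union_sdiff_of_subset hAX] at hσX
        exact hσX.2
      · exact hατ X (below_acjoin.2 (Or.inr ((below_im_dprod hχA').2
          ⟨hAX, below_singleton_dprod.1 (hσβ X hX)⟩)))
    intro σ hσ τ hτ h
    exact hσ.1.eq_of_below_iff hτ.1 fun X => ⟨key σ τ hσ hτ h X, key τ σ hτ hσ h.symm X⟩
  · rintro ρ ⟨hρ, hχ'ρ, hρχ⟩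
    rw [acle_iff_below] at hχ'ρ hρχ
    refine ⟨acjoin (dprod {A} ρ) (dprod (im A) χ), ⟨isAC_maxl _, acle_iff_below.2 fun X => ?_,
      acle_iff_below.2 fun X => ?_⟩,
      ((isAC_maxl _).link A).eq_of_below_iff hρ fun X => ?_⟩
    · simp only [below_acjoin, below_singleton_dprod]
      exact Or.imp_left (hχ'ρ _)
    · simp only [below_acjoin, below_singleton_dprod, below_im_dprod hχA']
      exact fun h => h.elim (hρχ _) And.right
    · change Below (link A (acjoin (dprod {A} ρ) (dprod (im A) χ))) X ↔ Below ρ X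
      simp only [below_link, below_acjoin, below_singleton_dprod, below_im_dprod hχA',
        Finset.subset_union_left, not_true_eq_false, false_and, or_false]
      constructor
      · rintro ⟨hXA, hX⟩
        rwa [union_sdiff hXA] at hX
      · intro hX
        have hXA := hχA X (hρχ X hX)
        exact ⟨hXA, by rwa [union_sdiff hXA]⟩

end Antichains
end

section
/- Let α ≤ β be antichains of subsets of a finite set N and let α' ∈ [α,β]. Then [α,β] is the union over all subsets χ ⊆ α' of the intervals [α ∨ χ, β ∧ (α' \ χ)ˇ], and these intervals are pairwise disjoint. -/
/-!
Antichains of subsets of a finite universe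
(following De Causmaecker & De Wannemacker,
"On the number of antichains of sets in a finite universe").
-/

open scoped Classical

namespace Antichains

variable {V : Type*} [DecidableEq V]

/-- `χˇ`: the largest antichain that does not dominate any member of `χ`,
i.e. the antichain of maximal sets containing no member of `χ`. -/
noncomputable def check [Fintype V] (χ : Finset (Finset V)) : Finset (Finset V) :=
  maxl (Finset.univ.filter fun Y : Finset V => ∀ X ∈ χ, ¬X ⊆ Y)

theorem exists_mem_maxl_of_mem {S : Finset (Finset V)} {X : Finset V} (hX : X ∈ S) :
    ∃ Y ∈ maxl S, X ⊆ Y := by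
  obtain ⟨Y, hXY, hY⟩ := S.exists_le_maximal hX
  exact ⟨Y, Finset.mem_filter.2 ⟨hY.prop, fun Z hZ => hY.not_gt hZ⟩, hXY⟩

theorem maxl_subset (S : Finset (Finset V)) : maxl S ⊆ S :=
  Finset.filter_subset _ _

theorem acle_trans {A B C : Finset (Finset V)} (hAB : acle A B) (hBC : acle B C) :
    acle A C := by
  intro X hX
  obtain ⟨Y, hY, hXY⟩ := hAB X hX
  obtain ⟨Z, hZ, hYZ⟩ := hBC Y hY
  exact ⟨Z, hZ, hXY.trans hYZ⟩

theorem acle_of_subset {A B : Finset (Finset V)} (h : A ⊆ B) : acle A B :=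
  fun X hX => ⟨X, h hX, subset_rfl⟩

theorem maxl_acle_iff {S A : Finset (Finset V)} : acle (maxl S) A ↔ acle S A :=
  ⟨acle_trans fun _ => exists_mem_maxl_of_mem, acle_trans (acle_of_subset (maxl_subset S))⟩

theorem acle_maxl_iff {S A : Finset (Finset V)} : acle A (maxl S) ↔ acle A S :=
  ⟨fun h => acle_trans h (acle_of_subset (maxl_subset S)),
    fun h => acle_trans h fun _ => exists_mem_maxl_of_mem⟩

theorem acjoin_acle_iff {A B C : Finset (Finset V)} :
    acle (acjoin A B) C ↔ acle A C ∧ acle B C := by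
  rw [acjoin, maxl_acle_iff]
  simp only [acle, Finset.mem_union, or_imp, forall_and]

theorem acle_acmeet_iff {A B C : Finset (Finset V)} :
    acle C (acmeet A B) ↔ acle C A ∧ acle C B := by
  rw [acmeet, acle_maxl_iff]
  constructor
  · refine fun h => ⟨fun X hX => ?_, fun X hX => ?_⟩ <;>
      obtain ⟨Y, hY, hXY⟩ := h X hX <;>
      obtain ⟨⟨P, Q⟩, hPQ, rfl⟩ := Finset.mem_image.1 hY <;>
      rw [Finset.mem_product] at hPQ
    · exact ⟨P, hPQ.1, hXY.trans Finset.inter_subset_left⟩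
    · exact ⟨Q, hPQ.2, hXY.trans Finset.inter_subset_right⟩
  · rintro ⟨hA, hB⟩ X hX
    obtain ⟨P, hP, hXP⟩ := hA X hX
    obtain ⟨Q, hQ, hXQ⟩ := hB X hX
    exact ⟨P ∩ Q, Finset.mem_image.2 ⟨(P, Q), Finset.mem_product.2 ⟨hP, hQ⟩, rfl⟩,
      Finset.subset_inter hXP hXQ⟩

theorem acle_check_iff [Fintype V] {A χ : Finset (Finset V)} :
    acle A (check χ) ↔ ∀ X ∈ χ, ∀ Y ∈ A, ¬X ⊆ Y := by
  rw [check, acle_maxl_iff]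
  constructor
  · intro h X hX Y hY hXY
    obtain ⟨Z, hZ, hYZ⟩ := h Y hY
    exact (Finset.mem_filter.1 hZ).2 X hX (hXY.trans hYZ)
  · exact fun h Y hY => ⟨Y, Finset.mem_filter.2 ⟨Finset.mem_univ Y, fun X hX => h X hX Y hY⟩,
      subset_rfl⟩

/-- Corollary 1 of the paper.  For antichains `a ≤ b` and
`a' ∈ [a, b]`, the interval `[a, b]` is the disjoint union, over the subsets
`χ ⊆ a'`, of the intervals `[a ∨ χ, b ∧ (a' \ χ)ˇ]`: an antichain belongs to `[a, b]`
iff it belongs to exactly one of these intervals. -/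
theorem statement8 {V : Type*} [DecidableEq V] [Fintype V] (a b a' : Finset (Finset V))
    (ha : IsAC a) (hb : IsAC b) (hab : acle a b) (ha' : memI a b a') :
    ∀ σ : Finset (Finset V), IsAC σ →
      ((acle a σ ∧ acle σ b) ↔
        ∃! χ : Finset (Finset V), χ ⊆ a' ∧ acle (acjoin a χ) σ ∧
          acle σ (acmeet b (check (a' \ χ)))) := by
  intro σ _
  simp only [acjoin_acle_iff, acle_acmeet_iff, acle_check_iff, Finset.mem_sdiff]
  constructor
  · rintro ⟨haσ, hσb⟩
    refine ⟨a'.filter fun X => ∃ Y ∈ σ, X ⊆ Y,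
      ⟨Finset.filter_subset _ _, ⟨haσ, fun X hX => (Finset.mem_filter.1 hX).2⟩, hσb, ?_⟩, ?_⟩
    · rintro X ⟨hX, hX'⟩ Y hY hXY
      exact hX' (Finset.mem_filter.2 ⟨hX, Y, hY, hXY⟩)
    · rintro χ ⟨hχ, ⟨-, hχσ⟩, -, hσχ⟩
      ext X
      rw [Finset.mem_filter]
      refine ⟨fun hX => ⟨hχ hX, hχσ X hX⟩, ?_⟩
      rintro ⟨hX, Y, hY, hXY⟩
      by_contra hXχ
      exact hσχ X ⟨hX, hXχ⟩ Y hY hXY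
  · rintro ⟨χ, ⟨-, ⟨haσ, -⟩, hσb, -⟩, -⟩
    exact ⟨haσ, hσb⟩

end Antichains
end

section
/- Let N = {1,…,n} and let {N₁, N₂} be a partition of N into two disjoint nonempty parts. Then the collection of intervals {[⊥,⊥]} ∪ {[α₁ ∨ α₂, α₁ ⊗ α₂] | α₁ ∈ A_{N₁}, α₂ ∈ A_{N₂}, α₁ ≠ ⊥, α₂ ≠ ⊥} is a partition of A_N: every antichain of subsets of N lies in exactly one of these intervals. -/
/-!
Antichains of subsets of a finite universe
(following De Causmaecker & De Wannemacker,
"On the number of antichains of sets in a finite universe").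
-/

open scoped Classical

namespace Antichains

variable {V : Type*} [DecidableEq V]

theorem acle_maxl (S : Finset (Finset V)) : acle S (maxl S) := by
  intro X hX
  obtain ⟨Y, hXY, hY⟩ := S.exists_le_maximal hX
  exact ⟨Y, Finset.mem_filter.2 ⟨hY.prop, fun Z hZ hYZ => hY.not_gt hZ hYZ⟩, hXY⟩

theorem subset_of_acle {A B : Finset (Finset V)} (hA : IsAC A) (hAB : acle A B)
    (hBA : acle B A) : A ⊆ B := by
  intro X hX
  obtain ⟨Y, hY, hXY⟩ := hAB X hX
  obtain ⟨Z, hZ, hYZ⟩ := hBA Y hY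
  obtain rfl := hA X hX Z hZ (hXY.trans hYZ)
  rwa [hXY.antisymm hYZ]

theorem acle_antisymm {A B : Finset (Finset V)} (hA : IsAC A) (hB : IsAC B)
    (hAB : acle A B) (hBA : acle B A) : A = B :=
  (subset_of_acle hA hAB hBA).antisymm (subset_of_acle hB hBA hAB)

theorem acle_dprod_iff {A B C : Finset (Finset V)} :
    acle C (dprod A B) ↔ ∀ X ∈ C, ∃ Y ∈ A, ∃ Z ∈ B, X ⊆ Y ∪ Z := by
  simp [acle, dprod, and_assoc]

/-- The antichain of maximal traces on `N` of the members of `χ`. -/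
def trace (N : Finset V) (χ : Finset (Finset V)) : Finset (Finset V) :=
  maxl (χ.image fun X => X ∩ N)

theorem acle_trace_iff {N : Finset V} {A χ : Finset (Finset V)} (hA : ∀ X ∈ A, X ⊆ N) :
    acle A (trace N χ) ↔ acle A χ := by
  constructor
  · intro h X hX
    obtain ⟨Y, hY, hXY⟩ := h X hX
    obtain ⟨Z, hZ, rfl⟩ := Finset.mem_image.1 (maxl_subset _ hY)
    exact ⟨Z, hZ, hXY.trans Finset.inter_subset_left⟩
  · refine fun h => acle_trans (fun X hX => ?_) (acle_maxl _)
    obtain ⟨Y, hY, hXY⟩ := h X hX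
    exact ⟨Y ∩ N, Finset.mem_image_of_mem _ hY, Finset.subset_inter hXY (hA X hX)⟩

theorem trace_acle_iff {N : Finset V} {A χ : Finset (Finset V)} :
    acle (trace N χ) A ↔ ∀ X ∈ χ, ∃ Y ∈ A, X ∩ N ⊆ Y := by
  constructor
  · exact fun h X hX => acle_trans (acle_maxl _) h _ (Finset.mem_image_of_mem _ hX)
  · intro h Y hY
    obtain ⟨X, hX, rfl⟩ := Finset.mem_image.1 (maxl_subset _ hY)
    exact h X hX

theorem subset_of_mem_trace {N : Finset V} {χ : Finset (Finset V)} :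
    ∀ X ∈ trace N χ, X ⊆ N := by
  intro Y hY
  obtain ⟨X, -, rfl⟩ := Finset.mem_image.1 (maxl_subset _ hY)
  exact Finset.inter_subset_right

theorem trace_nonempty {N : Finset V} {χ : Finset (Finset V)} (h : χ.Nonempty) :
    (trace N χ).Nonempty := by
  obtain ⟨X, hX⟩ := h
  obtain ⟨Y, hY, -⟩ := acle_maxl _ _ (Finset.mem_image_of_mem (fun X => X ∩ N) hX)
  exact ⟨Y, hY⟩

theorem inter_subset_of_subset_union {N X Y Z : Finset V} (h : X ⊆ Y ∪ Z)
    (hZ : Disjoint N Z) : X ∩ N ⊆ Y := by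
  intro x hx
  obtain ⟨hxX, hxN⟩ := Finset.mem_inter.1 hx
  exact (Finset.mem_union.1 (h hxX)).resolve_right (Finset.disjoint_left.1 hZ hxN)

/-- Theorem 2 of the paper.  Let `{N₁, N₁ᶜ}` be a partition of the
universe into two nonempty parts.  The collection consisting of the trivial interval
`[⊥, ⊥] = {⊥}` together with the intervals `[α₁ ∨ α₂, α₁ ⊗ α₂]` for nonempty
antichains `α₁` of subsets of `N₁` and `α₂` of subsets of `N₁ᶜ` partitions the lattice
of antichains: every nonempty antichain lies in exactly one interval
`[α₁ ∨ α₂, α₁ ⊗ α₂]`, and the empty antichain lies in none of them. -/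
theorem statement10 {V : Type*} [DecidableEq V] [Fintype V] (N₁ : Finset V)
    (h₁ : N₁.Nonempty) (h₂ : N₁ᶜ.Nonempty) :
    (∀ χ : Finset (Finset V), IsAC χ → χ.Nonempty →
      ∃! p : Finset (Finset V) × Finset (Finset V),
        (IsAC p.1 ∧ p.1.Nonempty ∧ ∀ X ∈ p.1, X ⊆ N₁) ∧
        (IsAC p.2 ∧ p.2.Nonempty ∧ ∀ X ∈ p.2, X ⊆ N₁ᶜ) ∧
        acle (acjoin p.1 p.2) χ ∧ acle χ (dprod p.1 p.2)) ∧
    (∀ p : Finset (Finset V) × Finset (Finset V),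
      (IsAC p.1 ∧ p.1.Nonempty ∧ ∀ X ∈ p.1, X ⊆ N₁) →
      (IsAC p.2 ∧ p.2.Nonempty ∧ ∀ X ∈ p.2, X ⊆ N₁ᶜ) →
        ¬acle (acjoin p.1 p.2) (∅ : Finset (Finset V))) := by
  refine ⟨fun χ _ hne => ⟨(trace N₁ χ, trace N₁ᶜ χ), ?_, ?_⟩, ?_⟩
  · refine ⟨⟨isAC_maxl _, trace_nonempty hne, subset_of_mem_trace⟩,
      ⟨isAC_maxl _, trace_nonempty hne, subset_of_mem_trace⟩, ?_, ?_⟩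
    · exact acjoin_acle_iff.2 ⟨(acle_trace_iff subset_of_mem_trace).1 (acle_of_subset subset_rfl),
        (acle_trace_iff subset_of_mem_trace).1 (acle_of_subset subset_rfl)⟩
    · refine acle_dprod_iff.2 fun X hX => ?_
      obtain ⟨Y, hY, hXY⟩ := trace_acle_iff.1 (acle_of_subset (subset_refl (trace N₁ χ))) X hX
      obtain ⟨Z, hZ, hXZ⟩ := trace_acle_iff.1 (acle_of_subset (subset_refl (trace N₁ᶜ χ))) X hX
      refine ⟨Y, hY, Z, hZ, fun x hx => ?_⟩
      by_cases hN : x ∈ N₁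
      · exact Finset.mem_union_left _ (hXY (Finset.mem_inter.2 ⟨hx, hN⟩))
      · exact Finset.mem_union_right _
          (hXZ (Finset.mem_inter.2 ⟨hx, Finset.mem_compl.2 hN⟩))
  · rintro ⟨A, B⟩ ⟨⟨hA, -, hAN⟩, ⟨hB, -, hBN⟩, hlow, hup⟩
    obtain ⟨hAχ, hBχ⟩ := acjoin_acle_iff.1 hlow
    have hup := acle_dprod_iff.1 hup
    refine Prod.ext (acle_antisymm hA (isAC_maxl _) ((acle_trace_iff hAN).2 hAχ) ?_)
      (acle_antisymm hB (isAC_maxl _) ((acle_trace_iff hBN).2 hBχ) ?_)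
    · refine trace_acle_iff.2 fun X hX => ?_
      obtain ⟨Y, hY, Z, hZ, h⟩ := hup X hX
      exact ⟨Y, hY, inter_subset_of_subset_union h
        (disjoint_compl_right.mono_right (hBN Z hZ))⟩
    · refine trace_acle_iff.2 fun X hX => ?_
      obtain ⟨Y, hY, Z, hZ, h⟩ := hup X hX
      exact ⟨Z, hZ, inter_subset_of_subset_union (Finset.union_comm Y Z ▸ h)
        (disjoint_compl_left.mono_right (hAN Y hY))⟩
  · rintro ⟨A, B⟩ ⟨-, ⟨X, hX⟩, -⟩ - h
    obtain ⟨Y, hY, -⟩ := (acjoin_acle_iff.1 h).1 X hX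
    exact Finset.notMem_empty Y hY

end Antichains
end

section
/- Let π be an antichain of pairwise disjoint nonempty sets, and define B_π = {α ∈ A_{∪π} | π ≤ α and for all A ∈ α and X ∈ π, X ⊆ A or X ∩ A = ∅}. Then (B_π, ≤) is order isomorphic to (B_{|π|}, ≤), where B_k denotes the basic interval [{{1},…,{k}}, {{1,…,k}}] in A_{{1,…,k}}. -/
/-!
Antichains of subsets of a finite universe
(following De Causmaecker & De Wannemacker,
"On the number of antichains of sets in a finite universe").
-/

open scoped Classical

namespace Antichains

variable {V : Type*} [DecidableEq V]

/-- The basic interval `B_n`: antichains `χ` of subsets of `{1,…,n}` with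
`{{1},…,{n}} ≤ χ ≤ {{1,…,n}}`. -/
noncomputable def Bset (n : ℕ) : Finset (Finset (Finset (Fin n))) :=
  Finset.univ.filter fun χ : Finset (Finset (Fin n)) =>
    IsAC χ ∧
    acle (Finset.univ.image fun i : Fin n => ({i} : Finset (Fin n))) χ ∧
    acle χ {(Finset.univ : Finset (Fin n))}

/-- The union of the blocks indexed by a set, as an order embedding, for a family of pairwise
disjoint nonempty blocks. -/
noncomputable def blockUnion {ι : Type*} (f : ι → Finset V)
    (hd : Pairwise fun i j => Disjoint (f i) (f j)) (hne : ∀ i, (f i).Nonempty) :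
    Finset ι ↪o Finset V :=
  OrderEmbedding.ofMapLEIff (fun S => S.biUnion f) fun S T => by
    refine ⟨fun h i hi => ?_, Finset.biUnion_subset_biUnion_of_subset_left f⟩
    obtain ⟨x, hx⟩ := hne i
    obtain ⟨j, hj, hxj⟩ := Finset.mem_biUnion.1 (h (Finset.mem_biUnion.2 ⟨i, hi, hx⟩))
    by_contra hiT
    have hij : i ≠ j := fun hij => hiT (hij ▸ hj)
    exact Finset.disjoint_left.1 (hd hij) hx hxj

theorem blockUnion_apply {ι : Type*} (f : ι → Finset V)
    (hd : Pairwise fun i j => Disjoint (f i) (f j)) (hne : ∀ i, (f i).Nonempty)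
    (S : Finset ι) : blockUnion f hd hne S = S.biUnion f :=
  rfl

/-- The unions of blocks are the sets covered by the blocks that separate no block. -/
theorem mem_range_blockUnion_iff {ι : Type*} [Fintype ι] (f : ι → Finset V)
    (hd : Pairwise fun i j => Disjoint (f i) (f j)) (hne : ∀ i, (f i).Nonempty)
    (A : Finset V) :
    A ∈ Set.range (blockUnion f hd hne) ↔
      A ⊆ Finset.univ.biUnion f ∧ ∀ i, f i ⊆ A ∨ Disjoint (f i) A := by
  constructor
  · rintro ⟨S, rfl⟩
    rw [blockUnion_apply]
    refine ⟨Finset.biUnion_subset_biUnion_of_subset_left f (Finset.subset_univ S), fun i => ?_⟩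
    by_cases hi : i ∈ S
    · exact Or.inl (Finset.subset_biUnion_of_mem f hi)
    · refine Or.inr ((Finset.disjoint_biUnion_right _ _ _).2 fun j hj => hd ?_)
      rintro rfl
      exact hi hj
  · rintro ⟨hA, hsep⟩
    refine ⟨Finset.univ.filter fun i => f i ⊆ A, ?_⟩
    rw [blockUnion_apply]
    ext x
    simp only [Finset.mem_biUnion, Finset.mem_filter, Finset.mem_univ, true_and]
    refine ⟨fun ⟨i, hi, hx⟩ => hi hx, fun hx => ?_⟩
    obtain ⟨i, -, hxi⟩ := Finset.mem_biUnion.1 (hA hx)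
    exact ⟨i, (hsep i).resolve_right fun h => Finset.disjoint_left.1 h hxi hx, hxi⟩

theorem acle_map_iff {U W : Type*} (g : Finset W ↪o Finset U) (A B : Finset (Finset W)) :
    acle (A.map g.toEmbedding) (B.map g.toEmbedding) ↔ acle A B := by
  simp only [acle, Finset.mem_map, forall_exists_index, and_imp, forall_apply_eq_imp_iff₂,
    exists_exists_and_eq_and]
  exact forall₂_congr fun X _ => exists_congr fun Y => and_congr_right fun _ => g.le_iff_le

theorem isAC_map_iff {U W : Type*} (g : Finset W ↪o Finset U) (A : Finset (Finset W)) :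
    IsAC (A.map g.toEmbedding) ↔ IsAC A := by
  simp only [IsAC, Finset.forall_mem_map]
  exact forall₂_congr fun X _ => forall₂_congr fun Y _ =>
    imp_congr g.le_iff_le g.injective.eq_iff

theorem mem_Bset_iff {n : ℕ} (χ : Finset (Finset (Fin n))) :
    χ ∈ Bset n ↔
      IsAC χ ∧ acle (Finset.univ.image fun i : Fin n => ({i} : Finset (Fin n))) χ := by
  simp [Bset, acle]

/-- Lemma 10 of the paper.  For an antichain `π` of pairwise
disjoint nonempty sets, the set `B_π` of antichains `α` of subsets of `∪π` with
`π ≤ α` in which no block of `π` is ever separated, ordered by domination, is order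
isomorphic to the basic interval `B_{|π|}`. -/
theorem statement14 {V : Type*} [DecidableEq V] [Fintype V] (π : Finset (Finset V))
    (hπ : IsAC π) (hdisj : ∀ X ∈ π, ∀ Y ∈ π, X ≠ Y → Disjoint X Y)
    (hne : ∀ X ∈ π, X.Nonempty) :
    ∃ e : {χ : Finset (Finset V) //
        IsAC χ ∧ acle π χ ∧ (∀ A ∈ χ, A ⊆ π.biUnion id) ∧
          ∀ A ∈ χ, ∀ X ∈ π, X ⊆ A ∨ Disjoint X A} ≃
      {χ : Finset (Finset (Fin π.card)) // χ ∈ Bset π.card},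
      ∀ x y, acle x.1 y.1 ↔ acle (e x).1 (e y).1 := by
  let b : Fin π.card ≃ π := π.equivFin.symm
  let f : Fin π.card → Finset V := fun i => (b i).1
  have hd : Pairwise fun i j => Disjoint (f i) (f j) := fun i j hij =>
    hdisj _ (b i).2 _ (b j).2 fun h => hij (b.injective (Subtype.ext h))
  have hf : ∀ X, X ∈ π ↔ ∃ i, f i = X := fun X =>
    ⟨fun hX => ⟨b.symm ⟨X, hX⟩, by simp [f]⟩, by rintro ⟨i, rfl⟩; exact (b i).2⟩
  let g := blockUnion f hd fun i => hne _ (b i).2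
  have hunion : π.biUnion id = Finset.univ.biUnion f := by
    ext x
    simp [hf]
  have hrange : ∀ A, A ∈ Set.range g ↔
      A ⊆ π.biUnion id ∧ ∀ X ∈ π, X ⊆ A ∨ Disjoint X A := fun A => by
    rw [mem_range_blockUnion_iff, hunion]
    simp [hf]
  have hπg : π = (Finset.univ.image fun i : Fin π.card => ({i} : Finset _)).map g.toEmbedding := by
    ext X
    simp [hf, g, blockUnion_apply]
  have hmem : ∀ χ : Finset (Finset (Fin π.card)), χ ∈ Bset π.card ↔
      IsAC (χ.map g.toEmbedding) ∧ acle π (χ.map g.toEmbedding) := fun χ => by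
    rw [mem_Bset_iff, isAC_map_iff, ← acle_map_iff g, ← hπg]
  let F : {χ : Finset (Finset (Fin π.card)) // χ ∈ Bset π.card} →
      {χ : Finset (Finset V) //
        IsAC χ ∧ acle π χ ∧ (∀ A ∈ χ, A ⊆ π.biUnion id) ∧
          ∀ A ∈ χ, ∀ X ∈ π, X ⊆ A ∨ Disjoint X A} := fun χ =>
    ⟨χ.1.map g.toEmbedding, ((hmem _).1 χ.2).1, ((hmem _).1 χ.2).2,
      Finset.forall_mem_map.2 fun S _ => ((hrange _).1 ⟨S, rfl⟩).1,
      Finset.forall_mem_map.2 fun S _ => ((hrange _).1 ⟨S, rfl⟩).2⟩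
  have hF : Function.Bijective F := by
    constructor
    · intro x y h
      exact Subtype.ext (Finset.map_injective _ (congrArg Subtype.val h))
    · rintro ⟨χ, hac, hle, hsub, hsep⟩
      obtain ⟨ψ, rfl⟩ : ∃ ψ : Finset (Finset (Fin π.card)), ψ.map g.toEmbedding = χ := by
        have hχ : (χ : Set (Finset V)) ⊆ g '' Set.univ := fun A hA => by
          rw [Set.image_univ]
          exact (hrange A).2 ⟨hsub A hA, hsep A hA⟩
        obtain ⟨ψ, -, hψ⟩ := Finset.subset_set_image_iff.1 hχ
        exact ⟨ψ, by rw [Finset.map_eq_image]; exact hψ⟩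
      exact ⟨⟨ψ, (hmem ψ).2 ⟨hac, hle⟩⟩, rfl⟩
  refine ⟨(Equiv.ofBijective F hF).symm, fun x y => ?_⟩
  rw [← acle_map_iff g]
  exact iff_of_eq (congrArg₂ (fun u v => acle u.1 v.1)
    (Equiv.ofBijective_apply_symm_apply F hF x).symm
    (Equiv.ofBijective_apply_symm_apply F hF y).symm)

end Antichains
end

section
/- For n ∈ ℕ, |B_n| = Σ_{k=0}^{n} S(n,k) · |D_k|, where S(n,k) is the Stirling number of the second kind, B_n is the basic interval of antichains of dimension n, and D_k is the set of antichains in B_k that distinguish all k elements (i.e. whose largest associated partition has size k). -/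
/-!
Antichains of subsets of a finite universe
(following De Causmaecker & De Wannemacker,
"On the number of antichains of sets in a finite universe").
-/

open scoped Classical

namespace Antichains

variable {V : Type*} [DecidableEq V]

/-- Stirling numbers of the second kind. -/
def stirling2 : ℕ → ℕ → ℕ
  | 0, 0 => 1
  | 0, _ + 1 => 0
  | _ + 1, 0 => 0
  | n + 1, k + 1 => (k + 1) * stirling2 n (k + 1) + stirling2 n k

/-- `D_k`: the antichains in the basic interval `B_k` that distinguish all `k`
elements (equivalently, whose largest associated partition is the discrete one). -/
noncomputable def Dset (k : ℕ) : Finset (Finset (Finset (Fin k))) :=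
  (Bset k).filter fun χ =>
    ∀ x y : Fin k, x ≠ y → ∃ A ∈ χ, (x ∈ A ∧ y ∉ A) ∨ (y ∈ A ∧ x ∉ A)

/-- Membership in the basic interval: an antichain covering the universe. -/
theorem mem_Bset {n : ℕ} {χ : Finset (Finset (Fin n))} :
    χ ∈ Bset n ↔ IsAC χ ∧ ∀ x : Fin n, ∃ A ∈ χ, x ∈ A := by
  simp [Bset, acle]

/-- `x` and `y` lie in the same members of `χ`. -/
def indist (χ : Finset (Finset V)) : Setoid V where
  r x y := ∀ A ∈ χ, x ∈ A ↔ y ∈ A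
  iseqv := ⟨fun _ _ _ => Iff.rfl, fun h A hA => (h A hA).symm,
    fun h₁ h₂ A hA => (h₁ A hA).trans (h₂ A hA)⟩

theorem mem_Dset {k : ℕ} {χ : Finset (Finset (Fin k))} :
    χ ∈ Dset k ↔ χ ∈ Bset k ∧ ∀ x y : Fin k, (∀ A ∈ χ, x ∈ A ↔ y ∈ A) → x = y := by
  rw [Dset, Finset.mem_filter]
  refine and_congr_right fun _ => forall₂_congr fun x y => ?_
  rw [not_imp_comm]
  refine imp_congr_left ?_
  push Not
  exact ⟨fun h A hA => ⟨(h A hA).1, (h A hA).2⟩, fun h A hA => ⟨(h A hA).1, (h A hA).2⟩⟩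

theorem surjective_cons_iff {β : Type*} {n : ℕ} (b : β) (g : Fin n → β) :
    Function.Surjective (Fin.cons b g : Fin (n + 1) → β) ↔ ∀ c, c ≠ b → ∃ i, g i = c := by
  refine forall_congr' fun c => ?_
  rw [Fin.exists_fin_succ]
  simp only [Fin.cons_zero, Fin.cons_succ]
  tauto

/-- Surjections onto the complement of a point. -/
def surjectiveNeEquiv {α β : Type*} (b : β) :
    {g : α → β // (∀ c, c ≠ b → ∃ i, g i = c) ∧ ¬ Function.Surjective g} ≃
      {g : α → {c : β // c ≠ b} // Function.Surjective g} where
  toFun g := ⟨fun i => ⟨g.1 i, fun h => g.2.2 fun c => by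
      by_cases hc : c = b
      · exact ⟨i, h.trans hc.symm⟩
      · exact g.2.1 c hc⟩,
    fun c => (g.2.1 c.1 c.2).imp fun _ h => Subtype.ext h⟩
  invFun g := ⟨fun i => (g.1 i).1,
    fun c hc => (g.2 ⟨c, hc⟩).imp fun _ h => congrArg Subtype.val h,
    fun h => by
      obtain ⟨i, hi⟩ := h b
      exact (g.1 i).2 hi⟩
  left_inv _ := rfl
  right_inv _ := rfl

theorem card_surjective (n : ℕ) : ∀ (β : Type) [Fintype β]
    [Fintype {f : Fin n → β // Function.Surjective f}],
    Fintype.card {f : Fin n → β // Function.Surjective f} =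
      (Fintype.card β).factorial * stirling2 n (Fintype.card β) := by
  induction n with
  | zero =>
    intro β _ _
    rcases isEmpty_or_nonempty β with hβ | hβ
    · have : ∀ f : Fin 0 → β, Function.Surjective f := fun f b => hβ.elim b
      simp [Fintype.card_subtype, this, stirling2]
    · obtain ⟨k, hk⟩ := Nat.exists_eq_succ_of_ne_zero (Fintype.card_ne_zero (α := β))
      have : ∀ f : Fin 0 → β, ¬ Function.Surjective f := fun f h =>
        (h hβ.some).elim fun i _ => i.elim0
      simp [this, hk, stirling2]
  | succ n ih =>
    intro β _ _
    have key : Fintype.card {f : Fin (n + 1) → β // Function.Surjective f} =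
        ∑ b : β, (Fintype.card {g : Fin n → β // Function.Surjective g} +
          Fintype.card {g : Fin n → {c : β // c ≠ b} // Function.Surjective g}) := by
      have e : {f : Fin (n + 1) → β // Function.Surjective f} ≃
          Σ b : β, {g : Fin n → β // ∀ c, c ≠ b → ∃ i, g i = c} :=
        { toFun f := ⟨f.1 0, Fin.tail f.1, by
            rw [← surjective_cons_iff, Fin.cons_self_tail]; exact f.2⟩
          invFun p := ⟨Fin.cons p.1 p.2.1, (surjective_cons_iff _ _).2 p.2.2⟩
          left_inv f := Subtype.ext (Fin.cons_self_tail f.1)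
          right_inv p := rfl }
      rw [Fintype.card_congr e, Fintype.card_sigma]
      refine Finset.sum_congr rfl fun b _ => ?_
      rw [← Fintype.card_congr (surjectiveNeEquiv (α := Fin n) b)]
      simp only [Fintype.card_subtype]
      rw [← Finset.card_filter_add_card_filter_not (p := Function.Surjective)
        (s := Finset.univ.filter fun g : Fin n → β => ∀ c, c ≠ b → ∃ i, g i = c),
        Finset.filter_filter, Finset.filter_filter]
      congr 2
      ext g
      simp only [Finset.mem_filter, Finset.mem_univ, true_and, and_iff_right_iff_imp]
      exact fun h c _ => h c
    rw [key]
    have compl_card : ∀ b : β, Fintype.card {c : β // c ≠ b} = Fintype.card β - 1 := fun b => by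
      rw [Fintype.card_subtype_compl, Fintype.card_subtype_eq]
    simp only [ih, compl_card, Finset.sum_const, Finset.card_univ, smul_eq_mul]
    cases Fintype.card β with
    | zero => simp [stirling2]
    | succ k =>
      simp only [stirling2, Nat.factorial_succ, Nat.add_sub_cancel]
      ring

/-- Surjections with a prescribed kernel are enumerations of the quotient. -/
theorem card_surjective_kernel {α β : Type*} [Fintype α] [Fintype β] (r : Setoid α) :
    (Finset.univ.filter fun f : α → β =>
      Function.Surjective f ∧ ∀ x y, f x = f y ↔ r x y).card =
      if Fintype.card (Quotient r) = Fintype.card β then (Fintype.card β).factorial else 0 := by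
  let e : (Quotient r ≃ β) ≃
      {f : α → β // Function.Surjective f ∧ ∀ x y, f x = f y ↔ r x y} :=
    { toFun e := ⟨fun x => e (Quotient.mk r x), e.surjective.comp Quotient.mk_surjective,
        fun x y => e.injective.eq_iff.trans Quotient.eq⟩
      invFun f := Equiv.ofBijective (Quotient.lift f.1 fun x y h => (f.2.2 x y).2 h)
        ⟨fun p q => Quotient.inductionOn₂ p q fun x y h => Quotient.sound ((f.2.2 x y).1 h),
          fun b => (f.2.1 b).elim fun x hx => ⟨Quotient.mk r x, hx⟩⟩
      left_inv e := Equiv.ext fun q => Quotient.inductionOn q fun _ => rfl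
      right_inv f := rfl }
  rw [← Fintype.card_subtype, ← Fintype.card_congr e]
  split_ifs with h
  · rw [Fintype.card_equiv (Fintype.equivOfCardEq h), h]
  · rw [Fintype.card_eq_zero_iff]
    exact ⟨fun e => h (Fintype.card_congr e)⟩

/-- Pulling back along a surjection `f` matches `D_k` with the members of `B_n` whose
indistinguishability relation is the kernel of `f`. -/
theorem card_Bset_kernel {n k : ℕ} (f : Fin n → Fin k) (hf : Function.Surjective f) :
    ((Bset n).filter fun χ => ∀ x y, f x = f y ↔ indist χ x y).card = (Dset k).card := by
  let pull : Finset (Fin k) → Finset (Fin n) := fun A => Finset.univ.filter fun x => f x ∈ A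
  have mem_pull : ∀ A x, x ∈ pull A ↔ f x ∈ A := fun A x => by simp [pull]
  have pull_subset : ∀ A B, pull A ⊆ pull B ↔ A ⊆ B := fun A B => by
    simp only [Finset.subset_iff, mem_pull]
    exact (hf.forall (p := fun y => y ∈ A → y ∈ B)).symm
  have pull_inj : Function.Injective pull := fun A B h =>
    ((pull_subset A B).1 h.subset).antisymm ((pull_subset B A).1 h.symm.subset)
  have ac_iff : ∀ δ : Finset (Finset (Fin k)), IsAC (δ.image pull) ↔ IsAC δ := fun δ => by
    simp only [IsAC, Finset.forall_mem_image, pull_subset, pull_inj.eq_iff]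
  have cover_iff : ∀ δ : Finset (Finset (Fin k)),
      (∀ x, ∃ A ∈ δ.image pull, x ∈ A) ↔ ∀ y, ∃ A ∈ δ, y ∈ A := fun δ => by
    simp only [Finset.exists_mem_image, mem_pull]
    exact (hf.forall (p := fun y => ∃ A ∈ δ, y ∈ A)).symm
  have ker_iff : ∀ δ : Finset (Finset (Fin k)), (∀ x y, f x = f y ↔ indist (δ.image pull) x y) ↔
      ∀ x y : Fin k, (∀ A ∈ δ, x ∈ A ↔ y ∈ A) → x = y := fun δ => by
    have : ∀ x y, indist (δ.image pull) x y ↔ ∀ A ∈ δ, f x ∈ A ↔ f y ∈ A := fun x y => by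
      change (∀ A ∈ δ.image pull, x ∈ A ↔ y ∈ A) ↔ _
      simp only [Finset.forall_mem_image, mem_pull]
    simp only [this]
    rw [hf.forall₂]
    exact forall₂_congr fun x y => ⟨fun h => h.2, fun h => ⟨fun e A _ => by rw [e], h⟩⟩
  have image_mem : ∀ δ : Finset (Finset (Fin k)),
      δ.image pull ∈ (Bset n).filter (fun χ => ∀ x y, f x = f y ↔ indist χ x y) ↔
        δ ∈ Dset k := fun δ => by
    rw [Finset.mem_filter, mem_Bset, mem_Dset, mem_Bset, ac_iff, cover_iff, ker_iff]
  symm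
  refine Finset.card_bij (fun δ _ => δ.image pull) (fun δ hδ => (image_mem δ).2 hδ)
    (fun δ _ ε _ h => Finset.image_injective pull_inj h) fun χ hχ => ?_
  have saturated : (χ.image fun A => A.image f).image pull = χ := by
    rw [Finset.image_image]
    refine (Finset.image_congr fun A hA => ?_).trans Finset.image_id
    ext x
    simp only [Function.comp_apply, mem_pull, Finset.mem_image, id]
    exact ⟨fun ⟨y, hy, e⟩ => (((Finset.mem_filter.1 hχ).2 y x).1 e A hA).1 hy,
      fun hx => ⟨x, hx, rfl⟩⟩
  exact ⟨_, (image_mem _).1 (by rwa [saturated]), saturated⟩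

/-- The number of members of `B_n` with exactly `k` indistinguishability classes. -/
theorem card_Bset_classes (n k : ℕ) :
    ((Bset n).filter fun χ => Fintype.card (Quotient (indist χ)) = k).card =
      stirling2 n k * (Dset k).card := by
  have h := Finset.sum_card_bipartiteAbove_eq_sum_card_bipartiteBelow
    (s := Finset.univ.filter fun f : Fin n → Fin k => Function.Surjective f) (t := Bset n)
    (fun f χ => ∀ x y, f x = f y ↔ indist χ x y)
  have left : ∀ f ∈ Finset.univ.filter fun f : Fin n → Fin k => Function.Surjective f,
      (Finset.bipartiteAbove (fun (f : Fin n → Fin k) χ => ∀ x y, f x = f y ↔ indist χ x y)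
        (Bset n) f).card = (Dset k).card := fun f hf =>
    card_Bset_kernel f (Finset.mem_filter.1 hf).2
  have right : ∀ χ ∈ Bset n,
      (Finset.bipartiteBelow (fun (f : Fin n → Fin k) χ => ∀ x y, f x = f y ↔ indist χ x y)
        (Finset.univ.filter fun f : Fin n → Fin k => Function.Surjective f) χ).card =
        if Fintype.card (Quotient (indist χ)) = k then k.factorial else 0 := fun χ _ => by
    rw [Finset.bipartiteBelow, Finset.filter_filter]
    convert card_surjective_kernel (β := Fin k) (indist χ) using 2
    · ext f
      simp only [Finset.mem_filter, Finset.mem_univ]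
    all_goals rw [Fintype.card_fin]
  rw [Finset.sum_congr rfl left, Finset.sum_congr rfl right, Finset.sum_const,
    ← Fintype.card_subtype, card_surjective] at h
  rw [Fintype.card_fin, ← Finset.sum_filter, Finset.sum_const, smul_eq_mul, smul_eq_mul, mul_assoc,
    mul_comm _ k.factorial] at h
  exact (Nat.eq_of_mul_eq_mul_left k.factorial_pos h).symm

/-- Lemma 12 of the paper.
`|B_n| = ∑_{k=0}^n S(n,k)·|D_k|` with `S(n,k)` the Stirling numbers of the
second kind. -/
theorem statement15 (n : ℕ) :
    (Bset n).card = ∑ k ∈ Finset.range (n + 1), stirling2 n k * (Dset k).card := by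
  rw [Finset.card_eq_sum_card_fiberwise (t := Finset.range (n + 1))
    (f := fun χ => Fintype.card (Quotient (indist χ)))]
  · exact Finset.sum_congr rfl fun k _ => card_Bset_classes n k
  · intro χ _
    simpa [Nat.lt_succ_iff] using Fintype.card_quotient_le (indist χ)

end Antichains
end

section
/- For n ∈ ℕ, the number of antichains of subsets of {1,…,n} satisfies |A_n| = Σ_{k=0}^{n} S(n+1, k+1) · |D_k|, where S(·,·) denotes Stirling numbers of the second kind and D_k is the set of antichains in the basic interval B_k that distinguish all k elements. -/
/-!
Antichains of subsets of a finite universe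
(following De Causmaecker & De Wannemacker,
"On the number of antichains of sets in a finite universe").
-/

open scoped Classical

namespace Antichains

variable {V : Type*} [DecidableEq V]

/-- `χ` is an antichain that covers and pairwise distinguishes the elements of `J`. -/
def Separates (J : Finset V) (χ : Finset (Finset V)) : Prop :=
  IsAC χ ∧ (∀ x ∈ J, ∃ A ∈ χ, x ∈ A) ∧
    ∀ x ∈ J, ∀ y ∈ J, x ≠ y → ∃ A ∈ χ, ¬(x ∈ A ↔ y ∈ A)

/-- The antichains of subsets of `U` that cover and pairwise distinguish the elements of `J`. -/
noncomputable def separating (U J : Finset V) : Finset (Finset (Finset V)) :=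
  U.powerset.powerset.filter (Separates J)

omit [DecidableEq V] in
theorem mem_separating {U J : Finset V} {χ : Finset (Finset V)} :
    χ ∈ separating U J ↔ (∀ A ∈ χ, A ⊆ U) ∧ Separates J χ := by
  simp [separating, Finset.subset_iff (s₂ := U.powerset)]

omit [DecidableEq V] in
theorem Separates.image {W : Type*} [DecidableEq W] {J : Finset V} {χ : Finset (Finset V)}
    (h : Separates J χ) (φ : V → W) (g : Finset V → Finset W)
    (hsub : ∀ A ∈ χ, ∀ B ∈ χ, g A ⊆ g B → A ⊆ B)
    (hmem : ∀ A ∈ χ, ∀ z ∈ J, φ z ∈ g A ↔ z ∈ A) :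
    Separates (J.image φ) (χ.image g) := by
  obtain ⟨h1, h2, h3⟩ := h
  refine ⟨?_, ?_, ?_⟩
  · intro X hX Y hY hXY
    obtain ⟨A, hA, rfl⟩ := Finset.mem_image.1 hX
    obtain ⟨B, hB, rfl⟩ := Finset.mem_image.1 hY
    rw [h1 A hA B hB (hsub A hA B hB hXY)]
  · intro x hx
    obtain ⟨z, hz, rfl⟩ := Finset.mem_image.1 hx
    obtain ⟨A, hA, hzA⟩ := h2 z hz
    exact ⟨g A, Finset.mem_image_of_mem g hA, (hmem A hA z hz).2 hzA⟩
  · intro x hx y hy hxy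
    obtain ⟨z, hz, rfl⟩ := Finset.mem_image.1 hx
    obtain ⟨w, hw, rfl⟩ := Finset.mem_image.1 hy
    obtain ⟨A, hA, hzw⟩ := h3 z hz w hw (fun e => hxy (e ▸ rfl))
    refine ⟨g A, Finset.mem_image_of_mem g hA, ?_⟩
    rwa [hmem A hA z hz, hmem A hA w hw]

theorem image_image_eq_self {W : Type*} [DecidableEq W] {χ : Finset (Finset V)}
    {f : Finset V → Finset W} {g : Finset W → Finset V} (h : ∀ A ∈ χ, g (f A) = A) :
    (χ.image f).image g = χ := by
  rw [Finset.image_image]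
  exact (Finset.image_congr (fun A hA => h A hA)).trans Finset.image_id

theorem filter_uncovered_separating (U J : Finset V) (x : V) :
    (separating U J).filter (fun χ => ∀ A ∈ χ, x ∉ A) = separating (U.erase x) J := by
  ext χ
  simp only [Finset.mem_filter, mem_separating, Finset.subset_erase]
  grind

theorem filter_distinguished_separating (U J : Finset V) {x : V} (hx : x ∉ J) :
    (separating U J).filter
        (fun χ => (∃ A ∈ χ, x ∈ A) ∧ ∀ y ∈ J, ∃ A ∈ χ, ¬(x ∈ A ↔ y ∈ A)) =
      separating U (insert x J) := by
  ext χ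
  simp only [Finset.mem_filter, mem_separating, Separates, Finset.mem_insert]
  grind

theorem card_filter_twin_separating {U J : Finset V} {x y : V} (hxU : x ∈ U) (hx : x ∉ J)
    (hy : y ∈ J) :
    ((separating U J).filter (fun χ => ∀ A ∈ χ, x ∈ A ↔ y ∈ A)).card =
      (separating (U.erase x) J).card := by
  have hxy : x ≠ y := fun e => hx (e ▸ hy)
  let d : Finset V → Finset V := fun A => A.erase x
  let e : Finset V → Finset V := fun A => if y ∈ A then insert x A else A
  have hd : ∀ A z, z ∈ d A ↔ z ≠ x ∧ z ∈ A := fun A z => Finset.mem_erase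
  have he : ∀ A z, z ∈ e A ↔ z ∈ A ∨ (z = x ∧ y ∈ A) := by
    intro A z
    by_cases h : y ∈ A <;> simp [e, h, or_comm]
  refine Finset.card_nbij' (fun χ => χ.image d) (fun χ => χ.image e) ?_ ?_ ?_ ?_
  · intro χ hχ
    obtain ⟨hχ, htw⟩ := Finset.mem_filter.1 hχ
    obtain ⟨hU, hS⟩ := mem_separating.1 hχ
    refine mem_separating.2 ⟨?_, ?_⟩
    · intro B hB
      obtain ⟨A, hA, rfl⟩ := Finset.mem_image.1 hB
      exact Finset.erase_subset_erase x (hU A hA)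
    · have := hS.image id d ?_ ?_
      · rwa [Finset.image_id] at this
      · intro A hA B hB hAB z hz
        have hAB' : ∀ z, z ≠ x ∧ z ∈ A → z ≠ x ∧ z ∈ B := fun z => by
          rw [← hd, ← hd]; exact @hAB z
        grind
      · intro A hA z hz
        rw [id, hd]
        grind
  · intro χ hχ
    obtain ⟨hU, hS⟩ := mem_separating.1 hχ
    have hxχ : ∀ A ∈ χ, x ∉ A := fun A hA => (Finset.subset_erase.1 (hU A hA)).2
    refine Finset.mem_filter.2 ⟨mem_separating.2 ⟨?_, ?_⟩, ?_⟩
    · intro B hB z hz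
      obtain ⟨A, hA, rfl⟩ := Finset.mem_image.1 hB
      rcases (he A z).1 hz with h | ⟨rfl, -⟩
      · exact Finset.mem_of_mem_erase (hU A hA h)
      · exact hxU
    · have := hS.image id e ?_ ?_
      · rwa [Finset.image_id] at this
      · intro A hA B hB hAB z hz
        have := (he B z).1 (hAB ((he A z).2 (Or.inl hz)))
        grind
      · intro A hA z hz
        rw [id, he]
        grind
    · intro B hB
      obtain ⟨A, hA, rfl⟩ := Finset.mem_image.1 hB
      rw [he, he]
      grind
  · intro χ hχ
    have htw := (Finset.mem_filter.1 hχ).2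
    refine image_image_eq_self fun A hA => ?_
    ext z
    rw [he, hd, hd]
    grind
  · intro χ hχ
    have hU := (mem_separating.1 hχ).1
    have hxχ : ∀ A ∈ χ, x ∉ A := fun A hA => (Finset.subset_erase.1 (hU A hA)).2
    refine image_image_eq_self fun A hA => ?_
    ext z
    rw [hd, he]
    grind

/-- An element outside `J` is uncovered, a twin of exactly one element of `J`, or can be
adjoined to `J`. -/
theorem card_separating_recurrence {U J : Finset V} {x : V} (hxU : x ∈ U) (hx : x ∉ J) :
    (separating U J).card =
      (J.card + 1) * (separating (U.erase x) J).card + (separating U (insert x J)).card := by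
  have hsplit : separating U J =
      (separating (U.erase x) J ∪
        J.biUnion fun y => (separating U J).filter fun χ => ∀ A ∈ χ, x ∈ A ↔ y ∈ A) ∪
      separating U (insert x J) := by
    rw [← filter_uncovered_separating, ← filter_distinguished_separating U J hx]
    ext χ
    simp only [Finset.mem_union, Finset.mem_biUnion, Finset.mem_filter]
    constructor
    · intro h
      by_cases h1 : ∀ A ∈ χ, x ∉ A
      · exact Or.inl (Or.inl ⟨h, h1⟩)
      by_cases h2 : ∃ y ∈ J, ∀ A ∈ χ, x ∈ A ↔ y ∈ A
      · obtain ⟨y, hy, h2⟩ := h2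
        exact Or.inl (Or.inr ⟨y, hy, h, h2⟩)
      · push Not at h1
        simp only [not_exists, not_and, not_forall] at h2
        exact Or.inr ⟨h, h1, fun y hy => by simpa using h2 y hy⟩
    · rintro ((h | ⟨y, -, h⟩) | h) <;> exact h.1
  have hdisj₁ : Disjoint (separating (U.erase x) J ∪
        J.biUnion fun y => (separating U J).filter fun χ => ∀ A ∈ χ, x ∈ A ↔ y ∈ A)
      (separating U (insert x J)) := by
    rw [← filter_uncovered_separating, ← filter_distinguished_separating U J hx,
      Finset.disjoint_left]
    intro χ
    simp only [Finset.mem_union, Finset.mem_biUnion, Finset.mem_filter]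
    grind
  have hdisj₂ : Disjoint (separating (U.erase x) J)
      (J.biUnion fun y => (separating U J).filter fun χ => ∀ A ∈ χ, x ∈ A ↔ y ∈ A) := by
    rw [← filter_uncovered_separating, Finset.disjoint_left]
    intro χ
    simp only [Finset.mem_biUnion, Finset.mem_filter, mem_separating, Separates]
    grind
  have hdisj₃ : ∀ y ∈ J, ∀ z ∈ J, y ≠ z →
      Disjoint ((separating U J).filter fun χ => ∀ A ∈ χ, x ∈ A ↔ y ∈ A)
        ((separating U J).filter fun χ => ∀ A ∈ χ, x ∈ A ↔ z ∈ A) := by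
    intro y hy z hz hyz
    rw [Finset.disjoint_left]
    intro χ h h'
    obtain ⟨hχ, h⟩ := Finset.mem_filter.1 h
    obtain ⟨A, hA, hyzA⟩ := (mem_separating.1 hχ).2.2.2 y hy z hz hyz
    exact hyzA ((h A hA).symm.trans ((Finset.mem_filter.1 h').2 A hA))
  conv_lhs => rw [hsplit]
  rw [Finset.card_union_of_disjoint hdisj₁, Finset.card_union_of_disjoint hdisj₂,
    Finset.card_biUnion hdisj₃,
    Finset.sum_congr rfl fun y hy => card_filter_twin_separating hxU hx hy]
  rw [Finset.sum_const, smul_eq_mul]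
  ring

theorem mem_Dset_s16 {k : ℕ} {χ : Finset (Finset (Fin k))} :
    χ ∈ Dset k ↔ Separates Finset.univ χ := by
  simp only [Dset, Bset, Separates, acle, Finset.mem_filter, Finset.mem_univ, true_and,
    Finset.mem_image, Finset.mem_singleton, exists_eq_left, Finset.subset_univ, implies_true,
    and_true, forall_exists_index, forall_apply_eq_imp_iff, Finset.singleton_subset_iff,
    true_imp_iff, and_assoc]
  have hiff : ∀ (x y : Fin k) (A : Finset (Fin k)),
      ¬(x ∈ A ↔ y ∈ A) ↔ (x ∈ A ∧ y ∉ A) ∨ (y ∈ A ∧ x ∉ A) := by grind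
  simp only [hiff]

theorem card_separating_self (J : Finset V) :
    (separating J J).card = (Dset J.card).card := by
  let φ : Fin J.card ↪ V := J.equivFin.symm.toEmbedding.trans (Function.Embedding.subtype _)
  have hφ : Finset.univ.image φ = J := by
    ext v
    simp only [Finset.mem_image, Finset.mem_univ, true_and]
    constructor
    · rintro ⟨i, rfl⟩
      exact (J.equivFin.symm i).2
    · intro hv
      exact ⟨J.equivFin ⟨v, hv⟩, by simp [φ]⟩
  let c : Finset V → Finset (Fin J.card) := fun A => Finset.univ.filter fun i => φ i ∈ A
  have hc : ∀ A i, i ∈ c A ↔ φ i ∈ A := fun A i => by simp [c]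
  have hmap : ∀ A : Finset (Fin J.card), c (A.map φ) = A := fun A => by ext i; simp [hc]
  have hcomap : ∀ A ⊆ J, (c A).map φ = A := by
    intro A hA
    ext v
    simp only [Finset.mem_map, hc]
    constructor
    · rintro ⟨i, hi, rfl⟩
      exact hi
    · intro hv
      obtain ⟨i, -, rfl⟩ := Finset.mem_image.1 (hφ ▸ hA hv)
      exact ⟨i, hv, rfl⟩
  refine Finset.card_nbij' (fun χ => χ.image c) (fun χ => χ.image (Finset.map φ)) ?_ ?_ ?_ ?_
  · intro χ hχ
    obtain ⟨hU, hS⟩ := mem_separating.1 hχ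
    have hS' : Separates (Finset.univ.image φ) χ := by rwa [hφ]
    obtain ⟨h1, h2, h3⟩ := hS'
    simp only [Finset.forall_mem_image] at h2 h3
    refine mem_Dset_s16.2 ⟨?_, fun i hi => ?_, fun i hi j hj hij => ?_⟩
    · intro X hX Y hY hXY
      obtain ⟨A, hA, rfl⟩ := Finset.mem_image.1 hX
      obtain ⟨B, hB, rfl⟩ := Finset.mem_image.1 hY
      have := Finset.map_subset_map (f := φ).2 hXY
      rw [hcomap A (hU A hA), hcomap B (hU B hB)] at this
      rw [h1 A hA B hB this]
    · obtain ⟨A, hA, hiA⟩ := h2 hi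
      exact ⟨c A, Finset.mem_image_of_mem c hA, (hc A i).2 hiA⟩
    · obtain ⟨A, hA, hiA⟩ := h3 hi hj (φ.injective.ne hij)
      exact ⟨c A, Finset.mem_image_of_mem c hA, by rwa [hc, hc]⟩
  · intro χ hχ
    have := (mem_Dset_s16.1 hχ).image φ (Finset.map φ) (fun A _ B _ h => Finset.map_subset_map.1 h)
      (fun A _ z _ => Finset.mem_map' φ)
    rw [hφ] at this
    refine mem_separating.2 ⟨fun B hB => ?_, this⟩
    obtain ⟨A, -, rfl⟩ := Finset.mem_image.1 hB
    rw [Finset.map_eq_image]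
    exact (Finset.image_subset_image (Finset.subset_univ A)).trans hφ.subset
  · intro χ hχ
    exact image_image_eq_self fun A hA => hcomap A ((mem_separating.1 hχ).1 A hA)
  · intro χ _
    exact image_image_eq_self fun A _ => hmap A

/-- The solution of the recurrence `card_separating_recurrence`, as a function of the numbers
of elements outside and inside `J`. -/
noncomputable def separatingCount : ℕ → ℕ → ℕ
  | 0, j => (Dset j).card
  | m + 1, j => (j + 1) * separatingCount m j + separatingCount m (j + 1)

theorem card_separating (m : ℕ) : ∀ {U J : Finset V}, J ⊆ U → (U \ J).card = m →
    (separating U J).card = separatingCount m J.card := by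
  induction m with
  | zero =>
    intro U J hJU hm
    rw [Finset.card_eq_zero, Finset.sdiff_eq_empty_iff_subset] at hm
    rw [Finset.Subset.antisymm hm hJU, card_separating_self, separatingCount]
  | succ m ih =>
    intro U J hJU hm
    obtain ⟨x, hx⟩ : (U \ J).Nonempty := Finset.card_pos.1 (by omega)
    obtain ⟨hxU, hxJ⟩ := Finset.mem_sdiff.1 hx
    have hcard : ((U \ J).erase x).card = m := by rw [Finset.card_erase_of_mem hx, hm]; rfl
    rw [card_separating_recurrence hxU hxJ, separatingCount,
      ih (Finset.subset_erase.2 ⟨hJU, hxJ⟩) (by rwa [Finset.erase_sdiff_comm]),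
      ih (Finset.insert_subset hxU hJU) (by rwa [Finset.sdiff_insert]),
      Finset.card_insert_of_notMem hxJ]

theorem stirling2_eq_zero_of_lt {n : ℕ} : ∀ {k : ℕ}, n < k → stirling2 n k = 0 := by
  induction n with
  | zero =>
    intro k hk
    obtain ⟨k, rfl⟩ := Nat.exists_eq_succ_of_ne_zero hk.ne'
    rfl
  | succ n ih =>
    intro k hk
    obtain ⟨k, rfl⟩ := Nat.exists_eq_succ_of_ne_zero (by omega : k ≠ 0)
    rw [stirling2, ih (by omega), ih (by omega), mul_zero]

theorem separatingCount_add (m l : ℕ) :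
    separatingCount (m + l) 0 =
      ∑ k ∈ Finset.range (m + 1), stirling2 (m + 1) (k + 1) * separatingCount l k := by
  induction m generalizing l with
  | zero => simp [stirling2]
  | succ m ih =>
    rw [show m + 1 + l = m + (l + 1) by ring, ih]
    have hrec : ∀ k, stirling2 (m + 1 + 1) (k + 1) =
        (k + 1) * stirling2 (m + 1) (k + 1) + stirling2 (m + 1) k := fun k => rfl
    simp only [hrec, separatingCount, mul_add, add_mul, Finset.sum_add_distrib]
    rw [Finset.sum_range_succ' (fun k => stirling2 (m + 1) k * separatingCount l k),
      Finset.sum_range_succ _ (m + 1), Finset.sum_range_succ _ (m + 1),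
      stirling2_eq_zero_of_lt (Nat.lt_succ_self (m + 1))]
    simp only [stirling2, zero_mul, mul_zero, add_zero]
    congr 2 <;> refine Finset.sum_congr rfl fun k _ => by ring

/-- Theorem 4 of the paper.  The number of antichains of subsets of
`{1,…,n}` (the Dedekind number of order `n`) satisfies
`|A_n| = ∑_{k=0}^n S(n+1,k+1)·|D_k|`. -/
theorem statement16 (n : ℕ) :
    (Finset.univ.filter fun χ : Finset (Finset (Fin n)) => IsAC χ).card =
      ∑ k ∈ Finset.range (n + 1), stirling2 (n + 1) (k + 1) * (Dset k).card := by
  have h := card_separating n (Finset.empty_subset (Finset.univ : Finset (Fin n))) (by simp)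
  rw [Finset.card_empty, ← Nat.add_zero n, separatingCount_add] at h
  simp only [separatingCount, Nat.add_zero] at h
  rw [← h]
  congr 1
  ext χ
  simp [mem_separating, Separates]

end Antichains
end
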